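/- arXiv:2501.08832 — 2 statements merged into one kernel-verified Lean document; each statement's English description precedes it below -/
import Mathlib

section
/- Let (Σ, μ) be a measure space, 1 < p < ∞ with conjugate exponent p′, f : Σ → B(H) a weakly integrable function with positive-semidefinite values, and g : Σ → [0,∞) integrable. Then ∫_Σ f(x) g(x) dμ(x) ≤ (∫_Σ g(x)^{p′} dμ(x))^{1/p′} · (∫_Σ f(x)^p dμ(x))^{1/p} in the Loewner order. -/
open MeasureTheory Matrix
open scoped ComplexOrder

open scoped NNReal

namespace CFC

variable {A : Type*} [CStarAlgebra A] [PartialOrder A] [StarOrderedRing A]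
variable {Ω : Type*} [MeasurableSpace Ω] {μ : Measure Ω}

lemma smul_rpow_of_nonneg {c q : ℝ} (hc : 0 ≤ c) (hq : 0 ≤ q) {a : A} (ha : 0 ≤ a) :
    (c • a) ^ q = c ^ q • a ^ q := by
  have hca : 0 ≤ c • a := smul_nonneg hc ha
  rw [rpow_eq_cfc_real hca, rpow_eq_cfc_real ha,
    ← cfc_comp_smul c (fun x : ℝ => x ^ q) a (Real.continuous_rpow_const hq).continuousOn,
    ← cfc_smul (c ^ q) _ a (Real.continuous_rpow_const hq).continuousOn]
  refine cfc_congr fun x hx => ?_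
  exact Real.mul_rpow hc (spectrum_nonneg_of_nonneg ha hx)

lemma continuousOn_rpow_of_nonneg {q : ℝ} (hq : 0 ≤ q) :
    ContinuousOn (fun a : A => a ^ q) {a : A | 0 ≤ a} := by
  obtain rfl | hq := hq.eq_or_lt
  · exact continuousOn_const.congr rpow_zero_eqOn
  · lift q to ℝ≥0 using hq.le
    simpa only [← nnrpow_eq_rpow (A := A) (NNReal.coe_pos.mp hq)] using
      continuousOn_nnrpow (A := A) q

/-- Jensen's inequality for the operator concave function `a ↦ a ^ q`, `q ∈ [0, 1]`. -/
lemma integral_rpow_le_rpow_integral [IsProbabilityMeasure μ] {q : ℝ} (hq : q ∈ Set.Icc 0 1)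
    {f : Ω → A} (hf : ∀ x, 0 ≤ f x) (hfi : Integrable f μ)
    (hfq : Integrable (fun x => f x ^ q) μ) :
    ∫ x, f x ^ q ∂μ ≤ (∫ x, f x ∂μ) ^ q := by
  have hclosed : IsClosed {z : A × A | z.1 ∈ Set.Ici 0 ∧ z.2 ≤ z.1 ^ q} := by
    have hIci : IsClosed {z : A × A | z.1 ∈ Set.Ici 0} := isClosed_Ici.preimage continuous_fst
    refine hIci.isClosed_le continuousOn_snd ?_
    exact (continuousOn_rpow_of_nonneg hq.1).comp continuousOn_fst fun z hz => hz
  have h := (concaveOn_rpow (A := A) hq).convex_hypograph.integral_mem (μ := μ) hclosed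
    (f := fun x => (f x, f x ^ q)) (ae_of_all _ fun x => ⟨hf x, le_rfl⟩) (hfi.prodMk hfq)
  rw [integral_pair hfi hfq] at h
  exact h.2

/-- Hölder's inequality for the integral of a positive operator-valued function against a
nonnegative scalar function. -/
theorem integral_smul_le_rpow_mul_rpow {p p' : ℝ} (hpp : p.HolderConjugate p')
    {f : Ω → A} (hf : ∀ x, 0 ≤ f x) {g : Ω → ℝ} (hg : ∀ x, 0 ≤ g x)
    (hfg : Integrable (fun x => g x • f x) μ) (hfp : Integrable (fun x => f x ^ p) μ)
    (hgp : Integrable (fun x => g x ^ p') μ) :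
    ∫ x, g x • f x ∂μ ≤ (∫ x, g x ^ p' ∂μ) ^ (1 / p') • (∫ x, f x ^ p ∂μ) ^ (1 / p) := by
  have hp := hpp.pos
  have hp' := hpp.symm.pos
  have hgp0 : 0 ≤ fun x => g x ^ p' := fun x => Real.rpow_nonneg (hg x) _
  set G := ∫ x, g x ^ p' ∂μ with hG
  have hG0 : 0 ≤ G := integral_nonneg hgp0
  obtain hGz | hGpos := hG0.eq_or_lt
  · have hz : ∀ᵐ x ∂μ, g x • f x = 0 := by
      filter_upwards [(integral_eq_zero_iff_of_nonneg hgp0 hgp).1 hGz.symm] with x hx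
      rw [(Real.rpow_eq_zero (hg x) hp'.ne').1 hx, zero_smul]
    rw [integral_congr_ae hz, ← hGz, Real.zero_rpow (one_div_pos.2 hp').ne']
    simp
  let w : Ω → ℝ≥0 := fun x => (G⁻¹ * g x ^ p').toNNReal
  have hw : ∀ x, (w x : ℝ) = G⁻¹ * g x ^ p' := fun x =>
    Real.coe_toNNReal _ (mul_nonneg (_root_.inv_nonneg.2 hG0) (hgp0 x))
  have hwm : AEMeasurable w μ := (hgp.aemeasurable.const_mul _).real_toNNReal
  let ν := μ.withDensity fun x => (w x : ENNReal)
  have : IsProbabilityMeasure ν := by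
    refine ⟨?_⟩
    rw [withDensity_apply _ MeasurableSet.univ, Measure.restrict_univ]
    change ∫⁻ x, ENNReal.ofReal (G⁻¹ * g x ^ p') ∂μ = 1
    rw [← ofReal_integral_eq_lintegral_ofReal (hgp.const_mul _)
      (ae_of_all _ fun x => mul_nonneg (_root_.inv_nonneg.2 hG0) (hgp0 x)), integral_const_mul, ← hG,
      inv_mul_cancel₀ hGpos.ne', ENNReal.ofReal_one]
  let F : Ω → A := fun x => g x ^ (-p') • f x ^ p
  have hF0 : ∀ x, 0 ≤ F x := fun x => smul_nonneg (Real.rpow_nonneg (hg x) _) rpow_nonneg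
  let S : Set Ω := {x | g x ^ p' ≠ 0}
  have hS : NullMeasurableSet S μ :=
    hgp.aemeasurable.nullMeasurable (measurableSet_singleton (0 : ℝ)).compl
  have hwF : (fun x => w x • F x) = fun x => G⁻¹ • S.indicator (fun x => f x ^ p) x := by
    ext x
    by_cases hx : g x ^ p' = 0
    · simp [NNReal.smul_def, hw, hx, S]
    · have hS' : x ∈ S := hx
      rw [Set.indicator_of_mem hS', NNReal.smul_def, hw, smul_smul, mul_assoc,
        Real.rpow_neg (hg x), mul_inv_cancel₀ hx, mul_one]
  have hFq : ∀ x, F x ^ (1 / p) = (g x ^ (-p')) ^ (1 / p) • f x := fun x => by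
    rw [smul_rpow_of_nonneg (Real.rpow_nonneg (hg x) _) (one_div_nonneg.2 hp.le) rpow_nonneg,
      rpow_rpow_of_exponent_nonneg _ _ _ hp.le (one_div_nonneg.2 hp.le) (hf x),
      mul_one_div_cancel hp.ne', rpow_one _ (hf x)]
  have hwFq : (fun x => w x • F x ^ (1 / p)) = fun x => G⁻¹ • g x • f x := by
    ext x
    rw [hFq, NNReal.smul_def, hw, smul_smul, smul_smul, mul_assoc]
    congr 2
    obtain hx | hx := (hg x).eq_or_lt
    · simp [← hx, Real.zero_rpow hp'.ne']
    · rw [← Real.rpow_mul hx.le, ← Real.rpow_add hx]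
      have : p' + -p' * (1 / p) = 1 := by
        have := hpp.inv_add_inv_eq_one
        field_simp at this ⊢
        linarith
      rw [this, Real.rpow_one]
  have hSi : Integrable (S.indicator fun x => f x ^ p) μ := hfp.indicator₀ hS
  have hFi : Integrable F ν := by
    rw [integrable_withDensity_iff_integrable_smul₀ hwm, hwF]
    exact hSi.smul _
  have hFqi : Integrable (fun x => F x ^ (1 / p)) ν := by
    rw [integrable_withDensity_iff_integrable_smul₀ hwm, hwFq]
    exact hfg.smul _
  have hq : 1 / p ∈ Set.Icc (0 : ℝ) 1 :=
    ⟨one_div_nonneg.2 hp.le, (div_le_one hp).2 hpp.lt.le⟩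
  have key := integral_rpow_le_rpow_integral hq hF0 hFi hFqi
  rw [integral_withDensity_eq_integral_smul₀ hwm, integral_withDensity_eq_integral_smul₀ hwm,
    hwF, hwFq, integral_smul, integral_smul] at key
  have hmono : ∫ x, S.indicator (fun x => f x ^ p) x ∂μ ≤ ∫ x, f x ^ p ∂μ :=
    integral_mono hSi hfp (Set.indicator_le_self' fun x _ => rpow_nonneg)
  have hle := key.trans
    (rpow_le_rpow hq (smul_le_smul_of_nonneg_left hmono (_root_.inv_nonneg.2 hG0)))
  rw [smul_rpow_of_nonneg (_root_.inv_nonneg.2 hG0) hq.1 (integral_nonneg fun x => rpow_nonneg)] at hle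
  have h := smul_le_smul_of_nonneg_left hle hG0
  rw [smul_smul, smul_smul, mul_inv_cancel₀ hGpos.ne', one_smul] at h
  convert h using 2
  rw [Real.inv_rpow hG0, ← Real.rpow_neg hG0, ← Real.rpow_one_add' hG0] <;>
    have := hpp.inv_add_inv_eq_one
  · congr 1
    rw [one_div, one_div]
    linarith
  · have := inv_pos.2 hp'
    rw [one_div]
    linarith

end CFC

open scoped Matrix.Norms.L2Operator MatrixOrder in
/-- The Bochner integral of a matrix-valued function is computed entrywise. -/
lemma Matrix.integrable_and_integral_eq_of_entries {n : ℕ} {Ω : Type*} [MeasurableSpace Ω]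
    {μ : Measure Ω} {F : Ω → Matrix (Fin n) (Fin n) ℂ}
    (hF : ∀ i j, Integrable (fun x => F x i j) μ) :
    Integrable F μ ∧ ∫ x, F x ∂μ = Matrix.of fun i j => ∫ x, F x i j ∂μ := by
  have hdecomp : F = fun x => ∑ i, ∑ j, F x i j • Matrix.single i j (1 : ℂ) := by
    ext1 x
    conv_lhs => rw [Matrix.matrix_eq_sum_single (F x)]
    simp
  have hFi : Integrable F μ := by
    rw [hdecomp]
    exact integrable_finsetSum _ fun i _ => integrable_finsetSum _ fun j _ =>
      (hF i j).smul_const _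
  refine ⟨hFi, ?_⟩
  ext i j
  let L : Matrix (Fin n) (Fin n) ℂ →L[ℂ] ℂ := (Matrix.entryLinearMap ℂ ℂ i j).toContinuousLinearMap
  exact (L.integral_comp_comm hFi).symm

/-- Operator-valued Hölder inequality: for a positive-semidefinite matrix-valued
function `f` and a nonnegative scalar function `g` with `1/p + 1/p' = 1`,
`∫ f g ≤ (∫ g^{p'})^{1/p'} • (∫ f^p)^{1/p}` in the Loewner order, where matrix
powers are taken via the (real) continuous functional calculus. -/
theorem op_holder {n : ℕ} {Ω : Type*} [MeasurableSpace Ω] (μ : Measure Ω)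
    (p p' : ℝ) (hp : 1 < p) (hpp' : 1 / p + 1 / p' = 1)
    (f : Ω → Matrix (Fin n) (Fin n) ℂ) (hf : ∀ x, (f x).PosSemidef)
    (g : Ω → ℝ) (hg0 : ∀ x, 0 ≤ g x) (hg : Integrable g μ)
    (hfg : ∀ i j, Integrable (fun x => (g x : ℂ) * f x i j) μ)
    (hfp : ∀ i j, Integrable (fun x => cfc (fun r : ℝ => r ^ p) (f x) i j) μ)
    (hgp : Integrable (fun x => g x ^ p') μ) :
    ((((∫ x, g x ^ p' ∂μ) ^ (1 / p') : ℝ) : ℂ) •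
        cfc (fun r : ℝ => r ^ (1 / p))
          (Matrix.of fun i j => ∫ x, cfc (fun r : ℝ => r ^ p) (f x) i j ∂μ) -
      (Matrix.of fun i j => ∫ x, (g x : ℂ) * f x i j ∂μ)).PosSemidef := by
  open scoped Matrix.Norms.L2Operator MatrixOrder in
  have hpp : p.HolderConjugate p' := Real.holderConjugate_iff.2 ⟨hp, by simpa using hpp'⟩
  have hf0 : ∀ x, 0 ≤ f x := fun x => (hf x).nonneg
  have hcfc : ∀ x, f x ^ p = cfc (fun r : ℝ => r ^ p) (f x) := fun x =>
    CFC.rpow_eq_cfc_real (hf0 x)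
  obtain ⟨hfgi, hfg_eq⟩ := Matrix.integrable_and_integral_eq_of_entries
    (F := fun x => g x • f x) (by simpa using hfg)
  obtain ⟨hfpi, hfp_eq⟩ := Matrix.integrable_and_integral_eq_of_entries
    (F := fun x => f x ^ p) (by simpa only [hcfc] using hfp)
  have h := CFC.integral_smul_le_rpow_mul_rpow hpp hf0 hg0 hfgi hfpi hgp
  rw [CFC.rpow_eq_cfc_real (integral_nonneg fun x => CFC.rpow_nonneg), hfg_eq, hfp_eq,
    Matrix.le_iff] at h
  simpa [hcfc] using h
end

section
/- Let 2 ≤ p < ∞ and let x₁, …, x_N be n×n complex matrices. Then (∑_{k=1}^N ‖x_k‖_{S_p}^p)^{1/p} ≤ ‖(∑_{k=1}^N x_k* x_k)^{1/2}‖_{S_p}, where ‖·‖_{S_p} denotes the Schatten p-norm. -/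
open Matrix
open scoped ComplexOrder

/-- The Schatten `p`-norm of a complex matrix: `‖x‖_{S_p} = (Tr |x|^p)^{1/p}`,
where `|x| = (xᴴ x)^{1/2}` is computed via the continuous functional calculus. -/
noncomputable def schattenNorm {n : ℕ} (p : ℝ) (x : Matrix (Fin n) (Fin n) ℂ) : ℝ :=
  ((cfc (fun r : ℝ => r ^ p) (cfc (fun r : ℝ => Real.sqrt r) (xᴴ * x))).trace.re) ^ (1 / p)

open scoped MatrixOrder

namespace Matrix

variable {n : ℕ} {A S : Matrix (Fin n) (Fin n) ℂ}

/-- The Löwner–Heinz inequality for matrices. -/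
lemma cfc_rpow_le_cfc_rpow (hA : 0 ≤ A) (h : A ≤ S) {r : ℝ} (hr : r ∈ Set.Icc (0 : ℝ) 1) :
    cfc (fun t : ℝ => t ^ r) A ≤ cfc (fun t : ℝ => t ^ r) S := by
  rw [← CFC.rpow_eq_cfc_real (a := A) hA, ← CFC.rpow_eq_cfc_real (hA.trans h)]
  open scoped Matrix.Norms.L2Operator in
  exact CFC.rpow_le_rpow hr h

lemma re_conj_diag_mono (h : A ≤ S) (U : Matrix (Fin n) (Fin n) ℂ) (j : Fin n) :
    ((Uᴴ * A * U) j j).re ≤ ((Uᴴ * S * U) j j).re := by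
  have h1 := ((Matrix.le_iff.mp h).conjTranspose_mul_mul_same U).diag_nonneg (i := j)
  have h2 := (Complex.le_def.mp h1).1
  rw [Matrix.mul_sub, Matrix.sub_mul] at h2
  simpa using h2

lemma IsHermitian.conj_cfc_eq_diagonal (hA : A.IsHermitian) (f : ℝ → ℝ) :
    (hA.eigenvectorUnitary : Matrix (Fin n) (Fin n) ℂ)ᴴ * cfc f A * hA.eigenvectorUnitary =
      diagonal fun i => (f (hA.eigenvalues i) : ℂ) := by
  have hU : (hA.eigenvectorUnitary : Matrix (Fin n) (Fin n) ℂ)ᴴ * hA.eigenvectorUnitary = 1 :=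
    Unitary.coe_star_mul_self hA.eigenvectorUnitary
  rw [hA.cfc_eq, IsHermitian.cfc, Unitary.conjStarAlgAut_apply, star_eq_conjTranspose]
  simp only [← Matrix.mul_assoc, hU, Matrix.one_mul]
  rw [Matrix.mul_assoc, hU, Matrix.mul_one]
  rfl

lemma IsHermitian.conj_eq_diagonal (hA : A.IsHermitian) :
    (hA.eigenvectorUnitary : Matrix (Fin n) (Fin n) ℂ)ᴴ * A * hA.eigenvectorUnitary =
      diagonal fun i => (hA.eigenvalues i : ℂ) := by
  have h := hA.conj_cfc_eq_diagonal id
  rwa [cfc_id ℝ A hA.isSelfAdjoint] at h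

lemma IsHermitian.trace_mul_eq_sum (hA : A.IsHermitian) (X : Matrix (Fin n) (Fin n) ℂ) :
    (X * A).trace.re = ∑ j, (((hA.eigenvectorUnitary : Matrix (Fin n) (Fin n) ℂ)ᴴ * X *
      hA.eigenvectorUnitary) j j).re * hA.eigenvalues j := by
  set U := (hA.eigenvectorUnitary : Matrix (Fin n) (Fin n) ℂ)
  have hU : U * Uᴴ = 1 := Unitary.coe_mul_star_self hA.eigenvectorUnitary
  have h : (X * A).trace = ((Uᴴ * X * U) * (Uᴴ * A * U)).trace := by
    rw [show (Uᴴ * X * U) * (Uᴴ * A * U) = Uᴴ * (X * (U * Uᴴ) * A * U) by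
      simp only [Matrix.mul_assoc], hU, Matrix.mul_one, trace_mul_comm Uᴴ, Matrix.mul_assoc, hU,
      Matrix.mul_one]
  rw [h, hA.conj_eq_diagonal]
  simp [trace, mul_diagonal]

lemma IsHermitian.trace_cfc_eq_sum (hA : A.IsHermitian) (f : ℝ → ℝ) :
    (cfc f A).trace.re = ∑ j, f (hA.eigenvalues j) := by
  set U := (hA.eigenvectorUnitary : Matrix (Fin n) (Fin n) ℂ)
  have hU : U * Uᴴ = 1 := Unitary.coe_mul_star_self hA.eigenvectorUnitary
  have h : (cfc f A).trace = (Uᴴ * cfc f A * U).trace := by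
    rw [Matrix.mul_assoc, trace_mul_comm, Matrix.mul_assoc, hU, Matrix.mul_one]
  rw [h, hA.conj_cfc_eq_diagonal]
  simp [trace]

end Matrix

lemma Real.rpow_tangent_le {r s t : ℝ} (hr : 1 ≤ r) (hs : 0 ≤ s) (ht : 0 ≤ t) :
    r * t ^ (r - 1) * s + (t ^ r - r * t ^ (r - 1) * t) ≤ s ^ r := by
  rcases ht.eq_or_lt with rfl | ht
  · rcases hr.eq_or_lt with rfl | hr
    · simp
    · rw [Real.zero_rpow (by linarith), Real.zero_rpow (by linarith)]
      simpa using Real.rpow_nonneg hs r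
  · have h := one_add_mul_self_le_rpow_one_add (s := s / t - 1)
      (by linarith [div_nonneg hs ht.le]) hr
    rw [add_sub_cancel, Real.div_rpow hs ht.le, le_div_iff₀ (Real.rpow_pos_of_pos ht r)] at h
    refine le_trans (le_of_eq ?_) h
    rw [Real.rpow_sub_one ht.ne']
    field_simp
    ring

namespace Matrix

variable {n : ℕ} {A S : Matrix (Fin n) (Fin n) ℂ}

lemma eigenvalues_rpow_le_conj_cfc_rpow (hA : 0 ≤ A) (h : A ≤ S) (hA' : A.IsHermitian)
    {r : ℝ} (hr : 0 ≤ r) (j : Fin n) :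
    hA'.eigenvalues j ^ r ≤
      (((hA'.eigenvectorUnitary : Matrix (Fin n) (Fin n) ℂ)ᴴ * cfc (fun t : ℝ => t ^ r) S *
        hA'.eigenvectorUnitary) j j).re := by
  have hS : 0 ≤ S := hA.trans h
  have hS' : IsSelfAdjoint S := hS.isSelfAdjoint
  rcases le_total r 1 with hr1 | hr1
  · have h1 := re_conj_diag_mono (cfc_rpow_le_cfc_rpow hA h ⟨hr, hr1⟩)
      (hA'.eigenvectorUnitary : Matrix (Fin n) (Fin n) ℂ) j
    rw [hA'.conj_cfc_eq_diagonal] at h1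
    simpa using h1
  · set U := (hA'.eigenvectorUnitary : Matrix (Fin n) (Fin n) ℂ)
    have hU : Uᴴ * U = 1 := Unitary.coe_star_mul_self hA'.eigenvectorUnitary
    set t := hA'.eigenvalues j
    have ht0 : 0 ≤ t := (nonneg_iff_posSemidef.mp hA).eigenvalues_nonneg j
    set c := r * t ^ (r - 1)
    have hc0 : 0 ≤ c := by positivity
    have hle : cfc (fun s : ℝ => c * s + (t ^ r - c * t)) S ≤ cfc (fun s : ℝ => s ^ r) S := by
      refine cfc_mono (fun s hs => Real.rpow_tangent_le hr1 (spectrum_nonneg_of_nonneg hS hs) ht0)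
        (by fun_prop) ?_
      exact (Real.continuous_rpow_const hr).continuousOn
    have hlin : cfc (fun s : ℝ => c * s + (t ^ r - c * t)) S =
        c • S + (t ^ r - c * t) • (1 : Matrix (Fin n) (Fin n) ℂ) := by
      rw [cfc_add_const _ _ _ (by fun_prop), cfc_const_mul_id c S, Algebra.algebraMap_eq_smul_one]
    have h1 := re_conj_diag_mono hle U j
    have h2 := re_conj_diag_mono h U j
    rw [hA'.conj_eq_diagonal] at h2
    rw [hlin] at h1
    simp only [Matrix.mul_add, Matrix.add_mul, Matrix.mul_smul, Matrix.smul_mul, hU, add_apply,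
      smul_apply, one_apply_eq, Complex.add_re, Complex.smul_re, Complex.one_re, smul_eq_mul,
      mul_one] at h1
    simp only [diagonal_apply_eq, Complex.ofReal_re] at h2
    have h3 := mul_le_mul_of_nonneg_left h2 hc0
    linarith

lemma trace_cfc_rpow_add_one_le (hA : 0 ≤ A) (h : A ≤ S) {r : ℝ} (hr : 0 ≤ r) :
    (cfc (fun t : ℝ => t ^ (r + 1)) A).trace.re ≤ (cfc (fun t : ℝ => t ^ r) S * A).trace.re := by
  have hA' := nonneg_iff_posSemidef.mp hA
  rw [hA'.1.trace_mul_eq_sum, hA'.1.trace_cfc_eq_sum]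
  refine Finset.sum_le_sum fun j _ => ?_
  have hj := hA'.eigenvalues_nonneg j
  rw [Real.rpow_add_one' hj (by linarith)]
  exact mul_le_mul_of_nonneg_right (eigenvalues_rpow_le_conj_cfc_rpow hA h hA'.1 hr j) hj

lemma cfc_rpow_mul_self (hS : 0 ≤ S) {r : ℝ} (hr : 0 ≤ r) :
    cfc (fun t : ℝ => t ^ r) S * S = cfc (fun t : ℝ => t ^ (r + 1)) S := by
  have hS' : IsSelfAdjoint S := hS.isSelfAdjoint
  nth_rewrite 2 [← cfc_id' ℝ S]
  rw [← cfc_mul (fun t : ℝ => t ^ r) (fun t : ℝ => t) S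
    (Real.continuous_rpow_const hr).continuousOn continuousOn_id]
  refine cfc_congr fun t ht => ?_
  exact (Real.rpow_add_one' (spectrum_nonneg_of_nonneg hS ht) (by linarith)).symm

/-- Superadditivity of `A ↦ Tr A ^ q` on positive semidefinite matrices, for `1 ≤ q`. -/
lemma sum_trace_cfc_rpow_le {ι : Type*} [Fintype ι] {A : ι → Matrix (Fin n) (Fin n) ℂ}
    (hA : ∀ k, 0 ≤ A k) {q : ℝ} (hq : 1 ≤ q) :
    ∑ k, (cfc (fun t : ℝ => t ^ q) (A k)).trace.re ≤
      (cfc (fun t : ℝ => t ^ q) (∑ k, A k)).trace.re := by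
  obtain ⟨r, hr, rfl⟩ : ∃ r : ℝ, 0 ≤ r ∧ q = r + 1 := ⟨q - 1, by linarith, by ring⟩
  rw [← cfc_rpow_mul_self (Finset.sum_nonneg fun k _ => hA k) hr, Finset.mul_sum, trace_sum,
    Complex.re_sum]
  exact Finset.sum_le_sum fun k _ => trace_cfc_rpow_add_one_le (hA k)
    (Finset.single_le_sum (fun i _ => hA i) (Finset.mem_univ k)) hr

lemma trace_cfc_rpow_nonneg (hA : 0 ≤ A) (q : ℝ) :
    0 ≤ (cfc (fun t : ℝ => t ^ q) A).trace.re := by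
  have hA' := nonneg_iff_posSemidef.mp hA
  rw [hA'.1.trace_cfc_eq_sum]
  exact Finset.sum_nonneg fun j _ => Real.rpow_nonneg (hA'.eigenvalues_nonneg j) q

lemma cfc_rpow_cfc_sqrt (hA : 0 ≤ A) {p : ℝ} (hp : 0 ≤ p) :
    cfc (fun r : ℝ => r ^ p) (cfc (fun r : ℝ => Real.sqrt r) A) =
      cfc (fun t : ℝ => t ^ (p / 2)) A := by
  have hA' : IsSelfAdjoint A := hA.isSelfAdjoint
  rw [← cfc_comp' _ _ A (Real.continuous_rpow_const hp).continuousOn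
    Real.continuous_sqrt.continuousOn]
  refine cfc_congr fun t ht => ?_
  have ht0 : 0 ≤ t := spectrum_nonneg_of_nonneg hA ht
  change Real.sqrt t ^ p = t ^ (p / 2)
  rw [Real.sqrt_eq_rpow, ← Real.rpow_mul ht0]
  congr 1
  ring

lemma conjTranspose_cfc_sqrt_mul_self (hA : 0 ≤ A) :
    (cfc (fun r : ℝ => Real.sqrt r) A)ᴴ * cfc (fun r : ℝ => Real.sqrt r) A = A := by
  have hA' : IsSelfAdjoint A := hA.isSelfAdjoint
  have h : IsSelfAdjoint (cfc (fun r : ℝ => Real.sqrt r) A) := cfc_predicate _ _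
  rw [← star_eq_conjTranspose, h.star_eq, ← cfc_mul _ _ A Real.continuous_sqrt.continuousOn
    Real.continuous_sqrt.continuousOn]
  conv_rhs => rw [← cfc_id' ℝ A]
  exact cfc_congr fun t ht => Real.mul_self_sqrt (spectrum_nonneg_of_nonneg hA ht)

end Matrix

lemma schattenNorm_eq {n : ℕ} {p : ℝ} (hp : 0 ≤ p) (x : Matrix (Fin n) (Fin n) ℂ) :
    schattenNorm p x = (cfc (fun t : ℝ => t ^ (p / 2)) (xᴴ * x)).trace.re ^ (1 / p) := by
  rw [schattenNorm, cfc_rpow_cfc_sqrt (posSemidef_conjTranspose_mul_self x).nonneg hp]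

/-- For `2 ≤ p < ∞`, `(∑ₖ ‖xₖ‖_{S_p}^p)^{1/p} ≤ ‖(∑ₖ xₖᴴ xₖ)^{1/2}‖_{S_p}`. -/
theorem schatten_sum_le {n N : ℕ} (p : ℝ) (hp : 2 ≤ p)
    (x : Fin N → Matrix (Fin n) (Fin n) ℂ) :
    (∑ k, schattenNorm p (x k) ^ p) ^ (1 / p) ≤
      schattenNorm p (cfc (fun r : ℝ => Real.sqrt r) (∑ k, (x k)ᴴ * x k)) := by
  have hp0 : 0 < p := by linarith
  have hx : ∀ k, 0 ≤ (x k)ᴴ * x k := fun k => (posSemidef_conjTranspose_mul_self (x k)).nonneg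
  have hpow : ∀ k, schattenNorm p (x k) ^ p =
      (cfc (fun t : ℝ => t ^ (p / 2)) ((x k)ᴴ * x k)).trace.re := fun k => by
    rw [schattenNorm_eq hp0.le, one_div,
      Real.rpow_inv_rpow (trace_cfc_rpow_nonneg (hx k) _) hp0.ne']
  rw [schattenNorm_eq hp0.le, conjTranspose_cfc_sqrt_mul_self (Finset.sum_nonneg fun k _ => hx k)]
  simp only [hpow]
  exact Real.rpow_le_rpow (Finset.sum_nonneg fun k _ => trace_cfc_rpow_nonneg (hx k) _)
    (sum_trace_cfc_rpow_le hx (by linarith)) (by positivity)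
end
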